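/- With the normalized values of β_j, γ_j determined by θ, for every (r,s,t) ∈ ℝ³ one has |∂Φ/∂s(r,s,t)|² = |∂Φ/∂t(r,s,t)|² = 2r²·(a + b·v(s) + c·w(t)), where a = 1/6, b = −(1/2)β₁β₂β₃ and c = −(1/2)γ₁γ₂γ₃. In particular the map (s,t) ↦ Φ(1,s,t) is conformal. -/

import Mathlib

noncomputable section

open Complex

/-- The Hermitian inner product on `ℂ³`. -/
def herm (a b : Fin 3 → ℂ) : ℂ :=
  a 0 * (starRingEnd ℂ) (b 0) + a 1 * (starRingEnd ℂ) (b 1) + a 2 * (starRingEnd ℂ) (b 2)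

/-- The squared Hermitian norm on `ℂ³`. -/
def hermSq (a : Fin 3 → ℂ) : ℝ :=
  Complex.normSq (a 0) + Complex.normSq (a 1) + Complex.normSq (a 2)

/-- The energy identity behind the norms of the partial derivatives: it holds for any two triples
with zero sum, orthogonal to each other, and with `p_j ^ 2 + q_j ^ 2 = 2 / 3`. -/
theorem sum_sq_mul_eq {p₁ p₂ p₃ q₁ q₂ q₃ : ℝ}
    (hp : p₁ + p₂ + p₃ = 0) (hq : q₁ + q₂ + q₃ = 0) (hpq : p₁ * q₁ + p₂ * q₂ + p₃ * q₃ = 0)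
    (hp2 : p₁ ^ 2 + p₂ ^ 2 + p₃ ^ 2 = 1)
    (h₁ : p₁ ^ 2 + q₁ ^ 2 = 2 / 3) (h₂ : p₂ ^ 2 + q₂ ^ 2 = 2 / 3) (h₃ : p₃ ^ 2 + q₃ ^ 2 = 2 / 3)
    (v w : ℝ) :
    p₁ ^ 2 * ((p₂ * v + 1) * (p₃ * v + 1)) * (q₁ * w + 1) +
        p₂ ^ 2 * ((p₃ * v + 1) * (p₁ * v + 1)) * (q₂ * w + 1) +
        p₃ ^ 2 * ((p₁ * v + 1) * (p₂ * v + 1)) * (q₃ * w + 1) =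
      1 - 3 * (p₁ * p₂ * p₃) * v - 3 * (q₁ * q₂ * q₃) * w := by
  have cube {x y z : ℝ} (h : x + y + z = 0) : x ^ 3 + y ^ 3 + z ^ 3 = 3 * (x * y * z) := by
    linear_combination (x ^ 2 + y ^ 2 + z ^ 2 - x * y - y * z - z * x) * h
  have hp2q : p₁ ^ 2 * q₁ + p₂ ^ 2 * q₂ + p₃ ^ 2 * q₃ = -3 * (q₁ * q₂ * q₃) := by
    linear_combination q₁ * h₁ + q₂ * h₂ + q₃ * h₃ - cube hq + 2 / 3 * hq
  have hp3q : p₁ ^ 3 * q₁ + p₂ ^ 3 * q₂ + p₃ ^ 3 * q₃ = 0 := by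
    linear_combination (p₁ ^ 2 * q₁ + p₂ ^ 2 * q₂ + p₃ ^ 2 * q₃) * hp -
      (p₁ * p₂ + p₂ * p₃ + p₃ * p₁) * hpq + p₁ * p₂ * p₃ * hq
  linear_combination p₁ * p₂ * p₃ * v ^ 2 * (hp + w * hpq) +
    v * (p₁ ^ 2 * (q₁ * w + 1) + p₂ ^ 2 * (q₂ * w + 1) + p₃ ^ 2 * (q₃ * w + 1)) * hp -
    v * cube hp - v * w * hp3q + hp2 + w * hp2q

/-- The derivative of a scaled coordinatewise product curve in `ℂ³`. -/
theorem deriv_vecCons_mul {f₁ f₂ f₃ : ℝ → ℂ} {f₁' f₂' f₃' : ℂ} {s : ℝ}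
    (h₁ : HasDerivAt f₁ f₁' s) (h₂ : HasDerivAt f₂ f₂' s) (h₃ : HasDerivAt f₃ f₃' s)
    (k c₁ c₂ c₃ : ℂ) :
    deriv (fun x => ![k * f₁ x * c₁, k * f₂ x * c₂, k * f₃ x * c₃]) s =
      ![k * f₁' * c₁, k * f₂' * c₂, k * f₃' * c₃] := by
  refine HasDerivAt.deriv (hasDerivAt_pi.2 fun i => ?_)
  fin_cases i
  · exact (h₁.const_mul k).mul_const c₁
  · exact (h₂.const_mul k).mul_const c₂
  · exact (h₃.const_mul k).mul_const c₃

/-- from Theorem 5.4 of the paper. With the normalized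
coefficients `β_j, γ_j` determined by `θ`, one has
`|∂Φ/∂s|² = |∂Φ/∂t|² = 2r²(a + b v(s) + c w(t))` where `a = 1/6`,
`b = −(1/2)β₁β₂β₃`, `c = −(1/2)γ₁γ₂γ₃`; in particular `(s,t) ↦ Φ(1,s,t)`
is conformal. -/
theorem stmt6
    (θ : ℝ) (β₁ β₂ β₃ γ₁ γ₂ γ₃ a b c : ℝ)
    (hβ₁ : β₁ = Real.cos θ / Real.sqrt 2 - Real.sin θ / Real.sqrt 6)
    (hβ₂ : β₂ = -(Real.cos θ / Real.sqrt 2) - Real.sin θ / Real.sqrt 6)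
    (hβ₃ : β₃ = 2 * Real.sin θ / Real.sqrt 6)
    (hγ₁ : γ₁ = -(Real.cos θ / Real.sqrt 6) - Real.sin θ / Real.sqrt 2)
    (hγ₂ : γ₂ = -(Real.cos θ / Real.sqrt 6) + Real.sin θ / Real.sqrt 2)
    (hγ₃ : γ₃ = 2 * Real.cos θ / Real.sqrt 6)
    (ha : a = 1 / 6)
    (hb : b = -(1 / 2) * (β₁ * β₂ * β₃))
    (hc : c = -(1 / 2) * (γ₁ * γ₂ * γ₃))
    (y₁ y₂ y₃ z₁ z₂ z₃ : ℝ → ℂ)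
    (hy₁ : ∀ s, HasDerivAt y₁ ((β₁ : ℂ) * (starRingEnd ℂ) (y₂ s * y₃ s)) s)
    (hy₂ : ∀ s, HasDerivAt y₂ ((β₂ : ℂ) * (starRingEnd ℂ) (y₃ s * y₁ s)) s)
    (hy₃ : ∀ s, HasDerivAt y₃ ((β₃ : ℂ) * (starRingEnd ℂ) (y₁ s * y₂ s)) s)
    (hz₁ : ∀ t, HasDerivAt z₁ ((γ₁ : ℂ) * (starRingEnd ℂ) (z₂ t * z₃ t)) t)
    (hz₂ : ∀ t, HasDerivAt z₂ ((γ₂ : ℂ) * (starRingEnd ℂ) (z₃ t * z₁ t)) t)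
    (hz₃ : ∀ t, HasDerivAt z₃ ((γ₃ : ℂ) * (starRingEnd ℂ) (z₁ t * z₂ t)) t)
    (v w : ℝ → ℝ)
    (hv₁ : ∀ s, Complex.normSq (y₁ s) = β₁ * v s + 1)
    (hv₂ : ∀ s, Complex.normSq (y₂ s) = β₂ * v s + 1)
    (hv₃ : ∀ s, Complex.normSq (y₃ s) = β₃ * v s + 1)
    (hw₁ : ∀ t, Complex.normSq (z₁ t) = γ₁ * w t + 1)
    (hw₂ : ∀ t, Complex.normSq (z₂ t) = γ₂ * w t + 1)
    (hw₃ : ∀ t, Complex.normSq (z₃ t) = γ₃ * w t + 1)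
    (Φ : ℝ → ℝ → ℝ → (Fin 3 → ℂ))
    (hΦ : ∀ r s t, Φ r s t =
      ![(Real.sqrt 3 : ℂ)⁻¹ * (r : ℂ) * y₁ s * z₁ t,
        (Real.sqrt 3 : ℂ)⁻¹ * (r : ℂ) * y₂ s * z₂ t,
        (Real.sqrt 3 : ℂ)⁻¹ * (r : ℂ) * y₃ s * z₃ t]) :
    ∀ r s t : ℝ,
      hermSq (deriv (fun x => Φ r x t) s) = 2 * r ^ 2 * (a + b * v s + c * w t) ∧
      hermSq (deriv (fun x => Φ r s x) t) = 2 * r ^ 2 * (a + b * v s + c * w t) ∧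
      (herm (deriv (fun x => Φ 1 x t) s) (deriv (fun x => Φ 1 s x) t)).re = 0 ∧
      hermSq (deriv (fun x => Φ 1 x t) s) = hermSq (deriv (fun x => Φ 1 s x) t) := by
  have trig := Real.sin_sq_add_cos_sq θ
  have inv2 : (Real.sqrt 2)⁻¹ ^ 2 = 1 / 2 := by
    rw [inv_pow, Real.sq_sqrt (by norm_num)]; norm_num
  have inv6 : (Real.sqrt 6)⁻¹ ^ 2 = 1 / 6 := by
    rw [inv_pow, Real.sq_sqrt (by norm_num)]; norm_num
  simp only [div_eq_mul_inv _ (Real.sqrt _)] at hβ₁ hβ₂ hβ₃ hγ₁ hγ₂ hγ₃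
  have hβ : β₁ + β₂ + β₃ = 0 := by rw [hβ₁, hβ₂, hβ₃]; ring
  have hγ : γ₁ + γ₂ + γ₃ = 0 := by rw [hγ₁, hγ₂, hγ₃]; ring
  have hβγ : β₁ * γ₁ + β₂ * γ₂ + β₃ * γ₃ = 0 := by
    rw [hβ₁, hβ₂, hβ₃, hγ₁, hγ₂, hγ₃]
    linear_combination (6 * Real.sin θ * Real.cos θ) * inv6 -
      (2 * Real.sin θ * Real.cos θ) * inv2
  have hβ2 : β₁ ^ 2 + β₂ ^ 2 + β₃ ^ 2 = 1 := by
    rw [hβ₁, hβ₂, hβ₃]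
    linear_combination (6 * Real.sin θ ^ 2) * inv6 + (2 * Real.cos θ ^ 2) * inv2 + trig
  have hγ2 : γ₁ ^ 2 + γ₂ ^ 2 + γ₃ ^ 2 = 1 := by
    rw [hγ₁, hγ₂, hγ₃]
    linear_combination (6 * Real.cos θ ^ 2) * inv6 + (2 * Real.sin θ ^ 2) * inv2 + trig
  have h₁ : β₁ ^ 2 + γ₁ ^ 2 = 2 / 3 := by
    rw [hβ₁, hγ₁]
    linear_combination (Real.sin θ ^ 2 + Real.cos θ ^ 2) * (inv6 + inv2) + 2 / 3 * trig
  have h₂ : β₂ ^ 2 + γ₂ ^ 2 = 2 / 3 := by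
    rw [hβ₂, hγ₂]
    linear_combination (Real.sin θ ^ 2 + Real.cos θ ^ 2) * (inv6 + inv2) + 2 / 3 * trig
  have h₃ : β₃ ^ 2 + γ₃ ^ 2 = 2 / 3 := by
    rw [hβ₃, hγ₃]
    linear_combination 4 * (Real.sin θ ^ 2 + Real.cos θ ^ 2) * inv6 + 2 / 3 * trig
  have inv3 : (Real.sqrt 3)⁻¹ * (Real.sqrt 3)⁻¹ = 1 / 3 := by
    rw [← mul_inv, Real.mul_self_sqrt (by norm_num)]; norm_num
  have hΦ' (r s t : ℝ) : Φ r s t =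
      ![(Real.sqrt 3 : ℂ)⁻¹ * (r : ℂ) * z₁ t * y₁ s,
        (Real.sqrt 3 : ℂ)⁻¹ * (r : ℂ) * z₂ t * y₂ s,
        (Real.sqrt 3 : ℂ)⁻¹ * (r : ℂ) * z₃ t * y₃ s] := by
    rw [hΦ, mul_right_comm _ (y₁ s), mul_right_comm _ (y₂ s), mul_right_comm _ (y₃ s)]
  have hds (r s t : ℝ) := deriv_vecCons_mul (hy₁ s) (hy₂ s) (hy₃ s)
    ((Real.sqrt 3 : ℂ)⁻¹ * (r : ℂ)) (z₁ t) (z₂ t) (z₃ t)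
  have hdt (r s t : ℝ) := deriv_vecCons_mul (hz₁ t) (hz₂ t) (hz₃ t)
    ((Real.sqrt 3 : ℂ)⁻¹ * (r : ℂ)) (y₁ s) (y₂ s) (y₃ s)
  simp only [← hΦ] at hds
  simp only [← hΦ'] at hdt
  have hs (r s t : ℝ) : hermSq (deriv (fun x => Φ r x t) s) =
      2 * r ^ 2 * (a + b * v s + c * w t) := by
    rw [hds, ha, hb, hc]
    simp only [hermSq, Matrix.cons_val, map_mul, map_inv₀, Complex.normSq_ofReal,
      Complex.normSq_conj, hv₁, hv₂, hv₃, hw₁, hw₂, hw₃, mul_inv, inv3]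
    linear_combination r ^ 2 / 3 * sum_sq_mul_eq hβ hγ hβγ hβ2 h₁ h₂ h₃ (v s) (w t)
  have ht (r s t : ℝ) : hermSq (deriv (fun x => Φ r s x) t) =
      2 * r ^ 2 * (a + b * v s + c * w t) := by
    rw [hdt, ha, hb, hc]
    simp only [hermSq, Matrix.cons_val, map_mul, map_inv₀, Complex.normSq_ofReal,
      Complex.normSq_conj, hv₁, hv₂, hv₃, hw₁, hw₂, hw₃, mul_inv, inv3]
    linear_combination r ^ 2 / 3 * sum_sq_mul_eq hγ hβ (by linear_combination hβγ) hγ2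
      ((add_comm _ _).trans h₁) ((add_comm _ _).trans h₂) ((add_comm _ _).trans h₃) (w t) (v s)
  have horth (r s t : ℝ) :
      herm (deriv (fun x => Φ r x t) s) (deriv (fun x => Φ r s x) t) = 0 := by
    rw [hds, hdt]
    simp only [herm, Matrix.cons_val, map_mul, map_inv₀, Complex.conj_ofReal, Complex.conj_conj]
    have hβγ' : (β₁ : ℂ) * γ₁ + β₂ * γ₂ + β₃ * γ₃ = 0 := by exact_mod_cast hβγ
    linear_combination ((Real.sqrt 3 : ℂ)⁻¹ * r) ^ 2 * (z₁ t * z₂ t * z₃ t) *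
      ((starRingEnd ℂ) (y₁ s) * (starRingEnd ℂ) (y₂ s) * (starRingEnd ℂ) (y₃ s)) * hβγ'
  intro r s t
  exact ⟨hs r s t, ht r s t, by rw [horth, Complex.zero_re], (hs 1 s t).trans (ht 1 s t).symm⟩
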